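/- Let d ≥ 2 and let σ denote the surface measure on the unit sphere {x ∈ ℝ^d : |x| = 1}. Let μ and ν be compactly supported finite Borel measures on ℝ^d satisfying ∫ |ξ|^{−(d−1)/2} |μ̂(ξ)|² dξ < ∞ and ∫ |ξ|^{−(d−1)/2} |ν̂(ξ)|² dξ < ∞. Then for every t > 0 the integral M(t) = ∫_{ℝ^d} σ̂(tξ) μ̂(ξ) \overline{ν̂(ξ)} dξ converges absolutely, and the function t ↦ M(t) is continuous on (0, ∞). -/

import Mathlib

open MeasureTheory Set Metric
open scoped ENNReal RealInnerProductSpace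

/-- The surface measure on the unit sphere in `ℝ^d`, realized as the `(d-1)`-dimensional
Hausdorff measure restricted to the sphere. -/
noncomputable def unitSphereMeasure (d : ℕ) : Measure (EuclideanSpace ℝ (Fin d)) :=
  (MeasureTheory.Measure.hausdorffMeasure ((d : ℝ) - 1)).restrict
    (Metric.sphere (0 : EuclideanSpace ℝ (Fin d)) 1)

/-- The Fourier transform `λ̂(ξ) = ∫ e^{-2πi x·ξ} dλ(x)` of a measure on `ℝ^d`. -/
noncomputable def fourierMeasure {d : ℕ} (lam : Measure (EuclideanSpace ℝ (Fin d)))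
    (ξ : EuclideanSpace ℝ (Fin d)) : ℂ :=
  ∫ x, Complex.exp (-(2 * Real.pi * ⟪x, ξ⟫) * Complex.I) ∂lam

/-- Energy bound for solutions of the radial Helmholtz equation. -/
theorem exists_abs_le_rpow_of_helmholtz (n : ℝ) {f f' : ℝ → ℝ}
    (hf : ∀ r, 0 < r → HasDerivAt f (f' r) r)
    (hf' : ∀ r, 0 < r → HasDerivAt f' (-(n / r) * f' r - f r) r) :
    ∃ C, 0 ≤ C ∧ ∀ r, 1 ≤ r → |f r| ≤ C * r ^ (-(n / 2)) := by
  set c : ℝ := |(n ^ 2 - 2 * n) / 4|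
  set h : ℝ → ℝ := fun r => f' r + n / (2 * r) * f r with hh
  set E : ℝ → ℝ := fun r => r ^ n * (f r ^ 2 + h r ^ 2) with hE
  set G : ℝ → ℝ := fun r => E r * Real.exp (c / r)
  have hE_deriv : ∀ r, 0 < r →
      HasDerivAt E (r ^ n * (2 * ((n ^ 2 - 2 * n) / 4) * (f r * h r) / r ^ 2)) r := by
    intro r hr
    have h1 : HasDerivAt (fun r : ℝ => n / (2 * r)) (-(n / (2 * r ^ 2))) r := by
      have := (hasDerivAt_inv hr.ne').const_mul (n / 2)
      refine (this.congr_of_eventuallyEq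
        (Filter.Eventually.of_forall fun x => ?_)).congr_deriv ?_ <;> field_simp
    have h2 := (hf' r hr).add (h1.mul (hf r hr))
    have h3 := (Real.hasDerivAt_rpow_const (p := n) (Or.inl hr.ne')).mul
      (((hf r hr).pow 2).add (h2.pow 2))
    refine h3.congr_deriv ?_
    rw [Real.rpow_sub_one hr.ne']
    simp only [hh, Pi.add_apply, Pi.mul_apply, Pi.pow_apply, Nat.add_one_sub_one, pow_one,
      Nat.cast_ofNat]
    have hr' := hr.ne'
    field_simp
    ring
  have hG_deriv : ∀ r, 0 < r → HasDerivAt G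
      (r ^ n * (2 * ((n ^ 2 - 2 * n) / 4) * (f r * h r) / r ^ 2) * Real.exp (c / r) +
        E r * (Real.exp (c / r) * (-(c / r ^ 2)))) r := by
    intro r hr
    refine (hE_deriv r hr).mul (HasDerivAt.exp ?_)
    have := (hasDerivAt_inv hr.ne').const_mul c
    exact this.congr_deriv (by ring)
  have hG_anti : AntitoneOn G (Ici 1) := by
    have hpos : ∀ r ∈ Ici (1 : ℝ), 0 < r := fun r hr => zero_lt_one.trans_le hr
    refine antitoneOn_of_deriv_nonpos (convex_Ici 1)
      (fun r hr => (hG_deriv r (hpos r hr)).continuousAt.continuousWithinAt)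
      (fun r hr => (hG_deriv r
        (hpos r (interior_subset hr))).differentiableAt.differentiableWithinAt) ?_
    intro r hr
    have hr0 := hpos r (interior_subset hr)
    rw [(hG_deriv r hr0).deriv]
    have key : 2 * ((n ^ 2 - 2 * n) / 4) * (f r * h r) ≤ c * (f r ^ 2 + h r ^ 2) := by
      calc 2 * ((n ^ 2 - 2 * n) / 4) * (f r * h r)
          ≤ |(n ^ 2 - 2 * n) / 4| * |2 * (f r * h r)| := by
            rw [← abs_mul]
            exact le_trans (le_of_eq (by ring)) (le_abs_self _)
        _ ≤ c * (f r ^ 2 + h r ^ 2) := by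
            refine mul_le_mul_of_nonneg_left (abs_le.2 ⟨?_, ?_⟩) (abs_nonneg _)
            · nlinarith [sq_nonneg (f r + h r)]
            · nlinarith [sq_nonneg (f r - h r)]
    have hrn : 0 < r ^ n := Real.rpow_pos_of_pos hr0 n
    have : r ^ n * (2 * ((n ^ 2 - 2 * n) / 4) * (f r * h r) / r ^ 2) * Real.exp (c / r) +
        E r * (Real.exp (c / r) * (-(c / r ^ 2))) =
        r ^ n * Real.exp (c / r) / r ^ 2 *
          (2 * ((n ^ 2 - 2 * n) / 4) * (f r * h r) - c * (f r ^ 2 + h r ^ 2)) := by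
      simp only [hE]
      ring
    rw [this]
    exact mul_nonpos_of_nonneg_of_nonpos (by positivity) (by linarith)
  refine ⟨Real.sqrt (G 1), Real.sqrt_nonneg _, fun r hr => ?_⟩
  have hr0 : 0 < r := zero_lt_one.trans_le hr
  have hEG : E r ≤ G 1 := by
    refine le_trans ?_ (hG_anti (mem_Ici.2 le_rfl) hr hr)
    refine le_mul_of_one_le_right (by positivity) (Real.one_le_exp (by positivity))
  have hsq : (r ^ (n / 2) * |f r|) ^ 2 ≤ G 1 := by
    have : (r ^ (n / 2)) ^ 2 = r ^ n := by
      rw [← Real.rpow_natCast, ← Real.rpow_mul hr0.le]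
      norm_num
    rw [mul_pow, this, sq_abs]
    refine le_trans ?_ hEG
    have hrn : 0 < r ^ n := Real.rpow_pos_of_pos hr0 n
    exact mul_le_mul_of_nonneg_left (by nlinarith [sq_nonneg (h r)]) hrn.le
  rw [Real.rpow_neg hr0.le, ← div_eq_mul_inv, le_div_iff₀ (Real.rpow_pos_of_pos hr0 _), mul_comm]
  exact Real.le_sqrt_of_sq_le hsq

/-- The Fourier integral `∫ g(x) e^{i x·v} dσ(x)` of a density `g` against a measure `σ`. -/
noncomputable def oscillatoryIntegral {d : ℕ} (σ : Measure (EuclideanSpace ℝ (Fin d)))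
    (g : EuclideanSpace ℝ (Fin d) → ℂ) (v : EuclideanSpace ℝ (Fin d)) : ℂ :=
  ∫ x, g x * Complex.exp (⟪x, v⟫ * Complex.I) ∂σ

section OscillatoryIntegral

variable {d : ℕ} {σ : Measure (EuclideanSpace ℝ (Fin d))}

theorem integrable_mul_exp_inner [IsFiniteMeasure σ] {g : EuclideanSpace ℝ (Fin d) → ℂ}
    (hg : Continuous g) {B : ℝ} (hB : ∀ᵐ x ∂σ, ‖g x‖ ≤ B) (v : EuclideanSpace ℝ (Fin d)) :
    Integrable (fun x => g x * Complex.exp (⟪x, v⟫ * Complex.I)) σ := by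
  refine Integrable.of_bound (by fun_prop) B ?_
  filter_upwards [hB] with x hx
  simpa [Complex.norm_exp_ofReal_mul_I] using hx

theorem hasDerivAt_oscillatoryIntegral [IsFiniteMeasure σ] (hσ : ∀ᵐ x ∂σ, ‖x‖ = 1)
    {g : EuclideanSpace ℝ (Fin d) → ℂ} (hg : Continuous g) {B : ℝ} (hB : ∀ᵐ x ∂σ, ‖g x‖ ≤ B)
    (v w : EuclideanSpace ℝ (Fin d)) (s : ℝ) :
    HasDerivAt (fun s : ℝ => oscillatoryIntegral σ g (v + s • w))
      (oscillatoryIntegral σ (fun x => Complex.I * ⟪x, w⟫ * g x) (v + s • w)) s := by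
  refine (hasDerivAt_integral_of_dominated_loc_of_deriv_le (s := univ)
    (F := fun (s : ℝ) x => g x * Complex.exp (⟪x, v + s • w⟫ * Complex.I))
    (F' := fun (s : ℝ) x => Complex.I * ⟪x, w⟫ * g x * Complex.exp (⟪x, v + s • w⟫ * Complex.I))
    (bound := fun _ => ‖w‖ * B) Filter.univ_mem
    (Filter.Eventually.of_forall fun s => (integrable_mul_exp_inner hg hB _).aestronglyMeasurable)
    (integrable_mul_exp_inner hg hB _) (by fun_prop) ?_ (integrable_const _) ?_).2
  · filter_upwards [hB, hσ] with x hx hx1 s _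
    simp only [norm_mul, Complex.norm_exp_ofReal_mul_I, Complex.norm_I, one_mul, mul_one,
      Complex.norm_real]
    have : ‖⟪x, w⟫‖ ≤ ‖w‖ := by simpa [hx1] using norm_inner_le_norm (𝕜 := ℝ) x w
    gcongr
  · refine Filter.Eventually.of_forall fun x s _ => ?_
    have h1 : HasDerivAt (fun s : ℝ => ⟪x, v + s • w⟫) ⟪x, w⟫ s := by
      simp only [inner_add_right, inner_smul_right]
      simpa using ((hasDerivAt_id s).mul_const ⟪x, w⟫).const_add ⟪x, v⟫
    have h2 := ((h1.ofReal_comp.mul_const Complex.I).cexp).const_mul (g x)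
    exact h2.congr_deriv (by ring)

/-- The Fourier transform of a measure invariant under linear isometries is radial. -/
theorem oscillatoryIntegral_one_congr_norm
    (hinv : ∀ e : EuclideanSpace ℝ (Fin d) ≃ₗᵢ[ℝ] EuclideanSpace ℝ (Fin d),
      MeasurePreserving e σ σ)
    {v w : EuclideanSpace ℝ (Fin d)} (h : ‖v‖ = ‖w‖) :
    oscillatoryIntegral σ 1 v = oscillatoryIntegral σ 1 w := by
  set e := Submodule.reflection (ℝ ∙ (v - w))ᗮ
  have hew : e v = w := Submodule.reflection_sub h
  unfold oscillatoryIntegral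
  rw [← (hinv e).integral_comp e.toHomeomorph.measurableEmbedding]
  refine integral_congr_ae (Filter.Eventually.of_forall fun x => ?_)
  simp only [Pi.one_apply]
  rw [← e.inner_map_map (e x), Submodule.reflection_reflection, hew]

variable [IsFiniteMeasure σ]

/-- The second derivative of a radial Fourier transform in a direction tangent to the sphere. -/
theorem oscillatoryIntegral_tangential (hσ : ∀ᵐ x ∂σ, ‖x‖ = 1)
    (hinv : ∀ e : EuclideanSpace ℝ (Fin d) ≃ₗᵢ[ℝ] EuclideanSpace ℝ (Fin d),
      MeasurePreserving e σ σ)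
    {u w : EuclideanSpace ℝ (Fin d)} (hu : ‖u‖ = 1) (hw : ‖w‖ = 1) (huw : ⟪u, w⟫ = 0)
    {r : ℝ} (hr : 0 < r) :
    oscillatoryIntegral σ (fun x => Complex.I * ⟪x, w⟫ * (Complex.I * ⟪x, w⟫)) (r • u) =
      oscillatoryIntegral σ (fun x => Complex.I * ⟪x, u⟫) (r • u) / r := by
  have hb1 : ∀ᵐ x ∂σ, ‖(1 : EuclideanSpace ℝ (Fin d) → ℂ) x‖ ≤ 1 := by simp
  have hbound : ∀ z : EuclideanSpace ℝ (Fin d), ‖z‖ = 1 →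
      ∀ᵐ x ∂σ, ‖Complex.I * (⟪x, z⟫ : ℂ)‖ ≤ 1 := fun z hz => by
    filter_upwards [hσ] with x hx
    simpa [hx, hz] using norm_inner_le_norm (𝕜 := ℝ) x z
  have hcont : ∀ z : EuclideanSpace ℝ (Fin d), Continuous fun x => Complex.I * (⟪x, z⟫ : ℂ) := by
    intro z; fun_prop
  have D1 : ∀ v z s, HasDerivAt (fun s : ℝ => oscillatoryIntegral σ 1 (v + s • z))
      (oscillatoryIntegral σ (fun x => Complex.I * ⟪x, z⟫) (v + s • z)) s := fun v z s => by
    simpa using hasDerivAt_oscillatoryIntegral hσ continuous_one hb1 v z s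
  set ρ : ℝ → ℝ := fun s => Real.sqrt (r ^ 2 + s ^ 2) with hρ
  have hρpos : ∀ s, 0 < r ^ 2 + s ^ 2 := fun s => by positivity
  have hρd : ∀ s, HasDerivAt ρ (s / ρ s) s := fun s => by
    have h1 : HasDerivAt (fun s : ℝ => r ^ 2 + s ^ 2) (2 * s) s := by
      simpa using ((hasDerivAt_id s).pow 2).const_add (r ^ 2)
    exact (h1.sqrt (hρpos s).ne').congr_deriv (mul_div_mul_left _ _ two_ne_zero)
  have hnorm : ∀ s, ‖r • u + s • w‖ = ρ s := fun s => by
    rw [hρ, eq_comm, Real.sqrt_eq_iff_eq_sq (hρpos s).le (norm_nonneg _), sq ‖_‖,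
      norm_add_sq_eq_norm_sq_add_norm_sq_real (by simp [inner_smul_left, inner_smul_right, huw])]
    simp [norm_smul, hu, hw, sq]
  have hrad : ∀ s, oscillatoryIntegral σ 1 (r • u + s • w) = oscillatoryIntegral σ 1 (ρ s • u) :=
    fun s => oscillatoryIntegral_one_congr_norm hinv
      (by rw [hnorm, norm_smul, hu, mul_one, Real.norm_of_nonneg (Real.sqrt_nonneg _)])
  have hfirst : ∀ s, oscillatoryIntegral σ (fun x => Complex.I * ⟪x, w⟫) (r • u + s • w) =
      (s / ρ s) • oscillatoryIntegral σ (fun x => Complex.I * ⟪x, u⟫) (ρ s • u) := fun s => by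
    have hA := D1 (r • u) w s
    have hB := D1 0 u (ρ s)
    simp only [hrad] at hA
    simp only [zero_add] at hB
    exact hA.unique (hB.scomp s (hρd s))
  have hρ0 : ρ 0 = r := by simp [hρ, hr.le]
  have hL := hasDerivAt_oscillatoryIntegral hσ (hcont w) (hbound w hw) (r • u) w 0
  have hR0 := hasDerivAt_oscillatoryIntegral hσ (hcont u) (hbound u hu) 0 u (ρ 0)
  simp only [zero_add] at hR0
  have hq : HasDerivAt (fun s => s / ρ s) (1 / r) 0 := by
    refine ((hasDerivAt_id (0 : ℝ)).div (hρd 0) (by rw [hρ0]; exact hr.ne')).congr_deriv ?_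
    rw [hρ0]
    simp
    field_simp
  have hR := hq.smul (hR0.scomp 0 (hρd 0))
  simp only [hfirst] at hL
  have := hL.unique hR
  simp only [Function.comp_apply, hρ0, zero_smul, add_zero, zero_div, zero_add] at this
  rw [this, Complex.real_smul]
  push_cast
  ring

end OscillatoryIntegral

section Decay

variable {d : ℕ} {σ : Measure (EuclideanSpace ℝ (Fin d))} [IsFiniteMeasure σ]

/-- The trace of the Hessian of the Fourier transform of a measure on the unit sphere. -/
theorem sum_oscillatoryIntegral_sq (hσ : ∀ᵐ x ∂σ, ‖x‖ = 1)
    (b : OrthonormalBasis (Fin d) ℝ (EuclideanSpace ℝ (Fin d))) (v : EuclideanSpace ℝ (Fin d)) :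
    ∑ j, oscillatoryIntegral σ (fun x => Complex.I * ⟪x, b j⟫ * (Complex.I * ⟪x, b j⟫)) v =
      -oscillatoryIntegral σ 1 v := by
  unfold oscillatoryIntegral
  rw [← integral_finsetSum, ← integral_neg]
  · refine integral_congr_ae ?_
    filter_upwards [hσ] with x hx
    have h1 : ∑ j, ((⟪x, b j⟫ : ℝ) : ℂ) ^ 2 = 1 := by
      have := b.sum_sq_norm_inner_left x
      simp only [Real.norm_eq_abs, sq_abs, hx, one_pow] at this
      exact_mod_cast this
    have h2 : ∀ j, Complex.I * ((⟪x, b j⟫ : ℝ) : ℂ) * (Complex.I * ((⟪x, b j⟫ : ℝ) : ℂ)) =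
        -((⟪x, b j⟫ : ℝ) : ℂ) ^ 2 := fun j => by
      linear_combination ((⟪x, b j⟫ : ℝ) : ℂ) ^ 2 * Complex.I_sq
    simp only [h2, ← Finset.sum_mul, Finset.sum_neg_distrib, h1, Pi.one_apply]
    ring
  · intro j _
    refine integrable_mul_exp_inner (B := 1) (by fun_prop) ?_ v
    filter_upwards [hσ] with x hx
    have : ‖⟪x, b j⟫‖ ≤ 1 := by simpa [hx] using norm_inner_le_norm (𝕜 := ℝ) x (b j)
    simp only [norm_mul, Complex.norm_I, one_mul, Complex.norm_real]
    exact mul_le_one₀ this (norm_nonneg _) this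

/-- The Fourier transform of an isometry invariant finite measure on the unit sphere of `ℝ^d`
decays with order `(d - 1) / 2`. -/
theorem exists_norm_oscillatoryIntegral_le (hd : 1 ≤ d) (hσ : ∀ᵐ x ∂σ, ‖x‖ = 1)
    (hinv : ∀ e : EuclideanSpace ℝ (Fin d) ≃ₗᵢ[ℝ] EuclideanSpace ℝ (Fin d),
      MeasurePreserving e σ σ) :
    ∃ C, 0 ≤ C ∧ ∀ v : EuclideanSpace ℝ (Fin d), v ≠ 0 →
      ‖oscillatoryIntegral σ 1 v‖ ≤ C * ‖v‖ ^ (-(((d : ℝ) - 1) / 2)) := by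
  set b := EuclideanSpace.basisFun (Fin d) ℝ
  set i₀ : Fin d := ⟨0, hd⟩
  set F : ℝ → ℂ := fun r => oscillatoryIntegral σ 1 (r • b i₀)
  set F' : ℝ → ℂ := fun r => oscillatoryIntegral σ (fun x => Complex.I * ⟪x, b i₀⟫) (r • b i₀)
  have hFd : ∀ r, HasDerivAt F (F' r) r := fun r => by
    simpa using hasDerivAt_oscillatoryIntegral hσ (g := 1) (B := 1) continuous_one (by simp)
      0 (b i₀) r
  have hF'd : ∀ r, 0 < r → HasDerivAt F' ((-(((d : ℝ) - 1) / r) : ℝ) * F' r - F r) r := by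
    intro r hr
    have h1 := hasDerivAt_oscillatoryIntegral hσ (g := fun x => Complex.I * ⟪x, b i₀⟫) (B := 1)
      (by fun_prop) (by
        filter_upwards [hσ] with x hx
        simpa [hx] using norm_inner_le_norm (𝕜 := ℝ) x (b i₀)) 0 (b i₀) r
    simp only [zero_add] at h1
    refine h1.congr_deriv ?_
    have h2 := sum_oscillatoryIntegral_sq hσ b (r • b i₀)
    have h3 : ∀ j ∈ Finset.univ.erase i₀,
        oscillatoryIntegral σ (fun x => Complex.I * ⟪x, b j⟫ * (Complex.I * ⟪x, b j⟫))
          (r • b i₀) = F' r / r := fun j hj =>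
      oscillatoryIntegral_tangential hσ hinv (b.norm_eq_one i₀) (b.norm_eq_one j)
        (b.inner_eq_zero (Finset.ne_of_mem_erase hj).symm) hr
    rw [← Finset.add_sum_erase _ _ (Finset.mem_univ i₀), Finset.sum_congr rfl h3] at h2
    simp only [Finset.sum_const, Finset.card_erase_of_mem (Finset.mem_univ i₀), Finset.card_univ,
      Fintype.card_fin, nsmul_eq_mul, Nat.cast_sub hd, Nat.cast_one] at h2
    rw [eq_sub_of_add_eq h2]
    push_cast
    ring
  obtain ⟨C₁, hC₁, h₁⟩ := exists_abs_le_rpow_of_helmholtz ((d : ℝ) - 1)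
    (f := fun r => (F r).re) (f' := fun r => (F' r).re)
    (fun r _ => Complex.reCLM.hasFDerivAt.comp_hasDerivAt r (hFd r))
    (fun r hr => (Complex.reCLM.hasFDerivAt.comp_hasDerivAt r (hF'd r hr)).congr_deriv (by
      simp only [Complex.reCLM_apply, Complex.sub_re, Complex.re_ofReal_mul]))
  obtain ⟨C₂, hC₂, h₂⟩ := exists_abs_le_rpow_of_helmholtz ((d : ℝ) - 1)
    (f := fun r => (F r).im) (f' := fun r => (F' r).im)
    (fun r _ => Complex.imCLM.hasFDerivAt.comp_hasDerivAt r (hFd r))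
    (fun r hr => (Complex.imCLM.hasFDerivAt.comp_hasDerivAt r (hF'd r hr)).congr_deriv (by
      simp only [Complex.imCLM_apply, Complex.sub_im, Complex.im_ofReal_mul]))
  refine ⟨C₁ + C₂ + σ.real univ, by positivity, fun v hv => ?_⟩
  have hv0 : 0 < ‖v‖ := norm_pos_iff.2 hv
  have hpow : 0 < ‖v‖ ^ (-(((d : ℝ) - 1) / 2)) := Real.rpow_pos_of_pos hv0 _
  have hd' : (1 : ℝ) ≤ d := by exact_mod_cast hd
  rcases le_total 1 ‖v‖ with h | h
  · have hvF : oscillatoryIntegral σ 1 v = F ‖v‖ :=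
      oscillatoryIntegral_one_congr_norm hinv (by simp [norm_smul])
    rw [hvF]
    have := Complex.norm_le_abs_re_add_abs_im (F ‖v‖)
    have := h₁ _ h
    have := h₂ _ h
    have : 0 ≤ σ.real univ * ‖v‖ ^ (-(((d : ℝ) - 1) / 2)) := by positivity
    linarith
  · have h1 : ‖oscillatoryIntegral σ 1 v‖ ≤ 1 * σ.real univ :=
      norm_integral_le_of_norm_le_const (Filter.Eventually.of_forall fun x => by
        simp [Complex.norm_exp_ofReal_mul_I])
    have h2 : 1 ≤ ‖v‖ ^ (-(((d : ℝ) - 1) / 2)) :=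
      Real.one_le_rpow_of_pos_of_le_one_of_nonpos hv0 h (by linarith)
    calc ‖oscillatoryIntegral σ 1 v‖ ≤ σ.real univ * 1 := by linarith
      _ ≤ _ := by gcongr; linarith

end Decay

theorem fourierMeasure_eq_oscillatoryIntegral {d : ℕ}
    (lam : Measure (EuclideanSpace ℝ (Fin d))) (ξ : EuclideanSpace ℝ (Fin d)) :
    fourierMeasure lam ξ = oscillatoryIntegral lam 1 ((-(2 * Real.pi)) • ξ) := by
  simp [fourierMeasure, oscillatoryIntegral, inner_smul_right]

theorem continuous_fourierMeasure {d : ℕ} (lam : Measure (EuclideanSpace ℝ (Fin d)))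
    [IsFiniteMeasure lam] : Continuous (fourierMeasure lam) := by
  refine continuous_of_dominated (bound := fun _ => 1) (fun ξ => by fun_prop) (fun ξ => ?_)
    (integrable_const _) (Filter.Eventually.of_forall fun x => by fun_prop)
  refine Filter.Eventually.of_forall fun x => le_of_eq ?_
  simpa using Complex.norm_exp_ofReal_mul_I (-(2 * Real.pi * ⟪x, ξ⟫))

theorem fourierMeasure_eq_zero_of_not_isFiniteMeasure {d : ℕ}
    {lam : Measure (EuclideanSpace ℝ (Fin d))} (h : ¬ IsFiniteMeasure lam) :
    fourierMeasure lam = 0 := by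
  ext ξ
  refine integral_undef fun hint => h ?_
  have h1 : Integrable (fun _ : EuclideanSpace ℝ (Fin d) => (1 : ℝ)) lam := by
    refine hint.norm.congr (Filter.Eventually.of_forall fun x => ?_)
    simpa using Complex.norm_exp_ofReal_mul_I (-(2 * Real.pi * ⟪x, ξ⟫))
  exact (integrable_const_iff_isFiniteMeasure one_ne_zero).1 h1

theorem ae_unitSphereMeasure_norm_eq_one (d : ℕ) : ∀ᵐ x ∂unitSphereMeasure d, ‖x‖ = 1 := by
  filter_upwards [ae_restrict_mem isClosed_sphere.measurableSet] with x hx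
  simpa using hx

theorem measurePreserving_unitSphereMeasure {d : ℕ}
    (e : EuclideanSpace ℝ (Fin d) ≃ₗᵢ[ℝ] EuclideanSpace ℝ (Fin d)) :
    MeasurePreserving e (unitSphereMeasure d) (unitSphereMeasure d) := by
  have h := (e.toIsometryEquiv.measurePreserving_hausdorffMeasure ((d : ℝ) - 1)).restrict_preimage
    (isClosed_sphere (x := (0 : EuclideanSpace ℝ (Fin d))) (ε := 1)).measurableSet
  have hpre : e.toIsometryEquiv ⁻¹' sphere (0 : EuclideanSpace ℝ (Fin d)) 1 = sphere 0 1 := by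
    ext x; simp
  rw [hpre] at h
  exact h

theorem exists_norm_fourierMeasure_unitSphereMeasure_le {d : ℕ} (hd : 1 ≤ d) :
    ∃ C, 0 ≤ C ∧ ∀ ξ : EuclideanSpace ℝ (Fin d), ξ ≠ 0 →
      ‖fourierMeasure (unitSphereMeasure d) ξ‖ ≤ C * ‖ξ‖ ^ (-(((d : ℝ) - 1) / 2)) := by
  by_cases hfin : IsFiniteMeasure (unitSphereMeasure d)
  · obtain ⟨C, hC, h⟩ := exists_norm_oscillatoryIntegral_le hd (ae_unitSphereMeasure_norm_eq_one d)
      measurePreserving_unitSphereMeasure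
    refine ⟨C * (2 * Real.pi) ^ (-(((d : ℝ) - 1) / 2)), by positivity, fun ξ hξ => ?_⟩
    rw [fourierMeasure_eq_oscillatoryIntegral]
    refine (h _ (smul_ne_zero (by simp [Real.pi_ne_zero]) hξ)).trans_eq ?_
    rw [norm_smul, norm_neg, Real.norm_of_nonneg (by positivity),
      Real.mul_rpow (by positivity) (norm_nonneg _), mul_assoc]
  · refine ⟨0, le_rfl, fun ξ _ => ?_⟩
    simp [fourierMeasure_eq_zero_of_not_isFiniteMeasure hfin]

theorem continuous_fourierMeasure_unitSphereMeasure (d : ℕ) :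
    Continuous (fourierMeasure (unitSphereMeasure d)) := by
  by_cases hfin : IsFiniteMeasure (unitSphereMeasure d)
  · exact continuous_fourierMeasure _
  · rw [fourierMeasure_eq_zero_of_not_isFiniteMeasure hfin]
    exact continuous_zero

theorem integrable_weight_mul_sq_fourierMeasure {d : ℕ} {k : ℝ}
    (lam : Measure (EuclideanSpace ℝ (Fin d))) [IsFiniteMeasure lam]
    (h : ∫⁻ ξ, ENNReal.ofReal (‖ξ‖ ^ k) * ‖fourierMeasure lam ξ‖₊ ^ 2 ∂volume ≠ ⊤) :
    Integrable (fun ξ => ‖ξ‖ ^ k * ‖fourierMeasure lam ξ‖ ^ 2) volume := by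
  have hm : Measurable fun ξ => ‖ξ‖ ^ k * ‖fourierMeasure lam ξ‖ ^ 2 :=
    (measurable_norm.pow_const k).mul ((continuous_fourierMeasure lam).norm.pow 2).measurable
  refine ⟨hm.aestronglyMeasurable, ?_⟩
  rw [hasFiniteIntegral_iff_ofReal (Filter.Eventually.of_forall fun ξ => by positivity)]
  refine lt_of_eq_of_lt (lintegral_congr fun ξ => ?_) h.lt_top
  rw [ENNReal.ofReal_mul (by positivity), ENNReal.ofReal_pow (norm_nonneg _), ofReal_norm]
  rfl

/-- Let `d ≥ 2`, let `σ` be the surface measure on the unit sphere of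
`ℝ^d`, and let `μ, ν` be compactly supported finite Borel measures with finite weighted
energies `∫ |ξ|^{-(d-1)/2} |μ̂(ξ)|² dξ < ∞` and `∫ |ξ|^{-(d-1)/2} |ν̂(ξ)|² dξ < ∞`. Then for
every `t > 0` the integral `M(t) = ∫ σ̂(tξ) μ̂(ξ) conj(ν̂(ξ)) dξ` converges absolutely, and
`t ↦ M(t)` is continuous on `(0,∞)`. -/
theorem distance_multiplier_continuous
    (d : ℕ) (hd : 2 ≤ d)
    (μ ν : Measure (EuclideanSpace ℝ (Fin d))) [IsFiniteMeasure μ] [IsFiniteMeasure ν]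
    (hμc : ∃ K : Set (EuclideanSpace ℝ (Fin d)), IsCompact K ∧ μ Kᶜ = 0)
    (hνc : ∃ K : Set (EuclideanSpace ℝ (Fin d)), IsCompact K ∧ ν Kᶜ = 0)
    (hμe : ∫⁻ ξ, ENNReal.ofReal (‖ξ‖ ^ (-(((d : ℝ) - 1) / 2))) *
        ‖fourierMeasure μ ξ‖₊ ^ 2 ∂volume ≠ ⊤)
    (hνe : ∫⁻ ξ, ENNReal.ofReal (‖ξ‖ ^ (-(((d : ℝ) - 1) / 2))) *
        ‖fourierMeasure ν ξ‖₊ ^ 2 ∂volume ≠ ⊤) :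
    (∀ t : ℝ, 0 < t →
        Integrable (fun ξ : EuclideanSpace ℝ (Fin d) =>
          fourierMeasure (unitSphereMeasure d) (t • ξ) * fourierMeasure μ ξ *
            (starRingEnd ℂ) (fourierMeasure ν ξ)) volume) ∧
      ContinuousOn
        (fun t : ℝ => ∫ ξ, fourierMeasure (unitSphereMeasure d) (t • ξ) *
          fourierMeasure μ ξ * (starRingEnd ℂ) (fourierMeasure ν ξ) ∂volume)
        (Set.Ioi (0 : ℝ)) := by
  set k : ℝ := -(((d : ℝ) - 1) / 2) with hk
  have hk0 : k ≤ 0 := by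
    have : (2 : ℝ) ≤ d := by exact_mod_cast hd
    linarith
  obtain ⟨C, hC, hdecay⟩ := exists_norm_fourierMeasure_unitSphereMeasure_le (d := d) (by omega)
  rw [← hk] at hdecay
  have hcσ := continuous_fourierMeasure_unitSphereMeasure d
  have hcμ := continuous_fourierMeasure μ
  have hcν := continuous_fourierMeasure ν
  have hmeas : ∀ t : ℝ, AEStronglyMeasurable (fun ξ : EuclideanSpace ℝ (Fin d) =>
      fourierMeasure (unitSphereMeasure d) (t • ξ) * fourierMeasure μ ξ *
        (starRingEnd ℂ) (fourierMeasure ν ξ)) volume := fun t =>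
    Continuous.aestronglyMeasurable (by fun_prop)
  have hne : ∀ᵐ ξ : EuclideanSpace ℝ (Fin d), ξ ≠ 0 := by
    have : Nonempty (Fin d) := ⟨⟨0, by omega⟩⟩
    exact compl_mem_ae_iff.2 (measure_singleton _)
  have hbound : ∀ s t : ℝ, 0 < s → s ≤ t → ∀ᵐ ξ : EuclideanSpace ℝ (Fin d),
      ‖fourierMeasure (unitSphereMeasure d) (t • ξ) * fourierMeasure μ ξ *
        (starRingEnd ℂ) (fourierMeasure ν ξ)‖ ≤ C * s ^ k *
          (‖ξ‖ ^ k * ‖fourierMeasure μ ξ‖ ^ 2 + ‖ξ‖ ^ k * ‖fourierMeasure ν ξ‖ ^ 2) := by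
    intro s t hs hst
    filter_upwards [hne] with ξ hξ
    have ht : 0 < t := hs.trans_le hst
    have h1 := hdecay (t • ξ) (smul_ne_zero ht.ne' hξ)
    rw [norm_smul, Real.norm_of_nonneg ht.le, Real.mul_rpow ht.le (norm_nonneg _)] at h1
    have h2 : t ^ k ≤ s ^ k := Real.rpow_le_rpow_of_nonpos hs hst hk0
    rw [norm_mul, norm_mul, RCLike.norm_conj, mul_assoc]
    calc _ ≤ C * (s ^ k * ‖ξ‖ ^ k) *
          (‖fourierMeasure μ ξ‖ ^ 2 + ‖fourierMeasure ν ξ‖ ^ 2) := by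
          refine mul_le_mul (h1.trans (by gcongr)) ?_ (by positivity) (by positivity)
          nlinarith [sq_nonneg (‖fourierMeasure μ ξ‖ - ‖fourierMeasure ν ξ‖),
            sq_nonneg ‖fourierMeasure μ ξ‖, sq_nonneg ‖fourierMeasure ν ξ‖]
      _ = _ := by ring
  have hint : ∀ s : ℝ, Integrable (fun ξ : EuclideanSpace ℝ (Fin d) => C * s ^ k *
      (‖ξ‖ ^ k * ‖fourierMeasure μ ξ‖ ^ 2 + ‖ξ‖ ^ k * ‖fourierMeasure ν ξ‖ ^ 2)) volume :=
    fun s => ((integrable_weight_mul_sq_fourierMeasure μ hμe).add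
      (integrable_weight_mul_sq_fourierMeasure ν hνe)).const_mul _
  refine ⟨fun t ht => (hint t).mono' (hmeas t) (hbound t t ht le_rfl), fun t ht => ?_⟩
  have ht0 : 0 < t := ht
  refine (continuousAt_of_dominated (Filter.Eventually.of_forall hmeas) ?_ (hint (t / 2))
    (Filter.Eventually.of_forall fun ξ => ?_)).continuousWithinAt
  · filter_upwards [Ioi_mem_nhds (half_lt_self ht0)] with s hs
    exact hbound _ s (half_pos ht0) (mem_Ioi.1 hs).le
  · exact Continuous.continuousAt (by fun_prop)
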